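/- Let π be any group. Then condition (M_{F₁⊆D}) holds for the group π × π: every element of D∖F₁ is contained in a unique element of D∖F₁ that is maximal in D∖F₁ with respect to inclusion. -/

import Mathlib

/-- The diagonal homomorphism `π → π × π`. -/
def diagHom (π : Type*) [Group π] : π →* π × π :=
  MonoidHom.prod (MonoidHom.id π) (MonoidHom.id π)

/-- The subgroup `H_{γ,S} = (γ,e)·Δ(Z_π(S))·(γ⁻¹,e)` of `π × π`. -/
def Hsub {π : Type*} [Group π] (γ : π) (S : Set π) : Subgroup (π × π) :=
  Subgroup.map (MulAut.conj ((γ, (1 : π)) : π × π)).toMonoidHom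
    (Subgroup.map (diagHom π) (Subgroup.centralizer S))

/-- The family of subgroups of `G` generated by a set `H` of subgroups: all conjugates of
members of `H` together with all their subgroups. -/
def famGen {G : Type*} [Group G] (H : Set (Subgroup G)) : Set (Subgroup G) :=
  {K | ∃ M ∈ H, ∃ g : G, K ≤ Subgroup.map (MulAut.conj g).toMonoidHom M}

/-- The family `D = F⟨Δ(π)⟩` of subgroups of `π × π`. -/
def famD (π : Type*) [Group π] : Set (Subgroup (π × π)) :=
  famGen {Subgroup.map (diagHom π) ⊤}

/-- The family `F₁ = F⟨{H_{γ,b} | γ ∈ π, b ∈ π∖{e}}⟩` of subgroups of `π × π`. -/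
def famF1 (π : Type*) [Group π] : Set (Subgroup (π × π)) :=
  famGen {K | ∃ γ b : π, b ≠ 1 ∧ K = Hsub γ ({b} : Set π)}

/-- Condition `(M_{E⊆F})`: every element of `F∖E` is contained in a unique element of `F∖E`
which is maximal in `F∖E` with respect to inclusion. -/
def conditionM {G : Type*} [Group G] (E F : Set (Subgroup G)) : Prop :=
  ∀ H ∈ F \ E, ∃! M : Subgroup G,
    M ∈ F \ E ∧ H ≤ M ∧ ∀ L ∈ F \ E, M ≤ L → M = L

/-- The twisted diagonal `{(γ x γ⁻¹, x)}`. -/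
def twistedDiag {π : Type*} [Group π] (γ : π) : Subgroup (π × π) :=
  Subgroup.map (MulAut.conj ((γ, (1 : π)) : π × π)).toMonoidHom (Subgroup.map (diagHom π) ⊤)

theorem mem_twistedDiag {π : Type*} [Group π] {γ : π} {p : π × π} :
    p ∈ twistedDiag γ ↔ p.1 = γ * p.2 * γ⁻¹ := by
  obtain ⟨a, x⟩ := p
  simp [twistedDiag, diagHom, eq_comm]

theorem mem_Hsub_singleton {π : Type*} [Group π] {γ b : π} {p : π × π} :
    p ∈ Hsub γ {b} ↔ p.1 = γ * p.2 * γ⁻¹ ∧ b * p.2 = p.2 * b := by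
  obtain ⟨a, x⟩ := p
  simp only [Hsub, diagHom, Subgroup.mem_map, Subgroup.mem_centralizer_singleton_iff]
  constructor
  · rintro ⟨_, ⟨y, hy, rfl⟩, h⟩
    simp only [MulEquiv.toMonoidHom_eq_coe, MonoidHom.coe_coe, MulAut.conj_apply,
      MonoidHom.prod_apply, MonoidHom.id_apply, Prod.inv_mk, Prod.mk_mul_mk, inv_one, one_mul,
      mul_one, Prod.mk.injEq] at h
    obtain ⟨rfl, rfl⟩ := h
    exact ⟨rfl, hy.symm⟩
  · rintro ⟨h, hx⟩
    exact ⟨(x, x), ⟨x, hx.symm, rfl⟩, by simpa using h.symm⟩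

theorem famGen_mono {G : Type*} [Group G] {S : Set (Subgroup G)} {K L : Subgroup G}
    (hKL : K ≤ L) (hL : L ∈ famGen S) : K ∈ famGen S := by
  obtain ⟨M, hM, g, hg⟩ := hL
  exact ⟨M, hM, g, hKL.trans hg⟩

theorem mem_famD_iff {π : Type*} [Group π] {K : Subgroup (π × π)} :
    K ∈ famD π ↔ ∃ γ : π, K ≤ twistedDiag γ := by
  constructor
  · rintro ⟨_, rfl, ⟨g, h⟩, hK⟩
    refine ⟨g * h⁻¹, fun p hp => mem_twistedDiag.2 ?_⟩
    obtain ⟨_, ⟨y, -, rfl⟩, rfl⟩ := hK hp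
    simp [diagHom, mul_assoc]
  · rintro ⟨γ, hK⟩
    exact ⟨_, rfl, (γ, 1), hK⟩

/-- A subgroup lying in two distinct twisted diagonals belongs to `F₁`. -/
theorem mem_famF1_of_le_twistedDiag {π : Type*} [Group π] {K : Subgroup (π × π)} {γ δ : π}
    (hne : γ ≠ δ) (hγ : K ≤ twistedDiag γ) (hδ : K ≤ twistedDiag δ) : K ∈ famF1 π := by
  refine ⟨Hsub γ {δ⁻¹ * γ}, ⟨γ, δ⁻¹ * γ, fun h => hne (inv_mul_eq_one.1 h).symm, rfl⟩, 1, ?_⟩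
  intro p hp
  have h₁ := mem_twistedDiag.1 (hγ hp)
  have h₂ := mem_twistedDiag.1 (hδ hp)
  refine ⟨p, mem_Hsub_singleton.2 ⟨h₁, ?_⟩, by simp⟩
  have h : γ * p.2 * γ⁻¹ = δ * p.2 * δ⁻¹ := h₁.symm.trans h₂
  calc δ⁻¹ * γ * p.2 = δ⁻¹ * (γ * p.2 * γ⁻¹) * γ := by group
    _ = δ⁻¹ * (δ * p.2 * δ⁻¹) * γ := by rw [h]
    _ = p.2 * (δ⁻¹ * γ) := by group

/-- For any group `π`, condition `(M_{F₁⊆D})` holds for the group `π × π`. -/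
theorem conditionM_F1_D (π : Type*) [Group π] : conditionM (famF1 π) (famD π) := by
  rintro H ⟨hHD, hHF⟩
  obtain ⟨γ, hγ⟩ := mem_famD_iff.1 hHD
  have le_of_mem : ∀ L ∈ famD π, H ≤ L → L ≤ twistedDiag γ := by
    intro L hL hHL
    obtain ⟨δ, hδ⟩ := mem_famD_iff.1 hL
    obtain rfl : γ = δ := by
      by_contra hne
      exact hHF (mem_famF1_of_le_twistedDiag hne hγ (hHL.trans hδ))
    exact hδ
  have hmem : twistedDiag γ ∈ famD π \ famF1 π :=
    ⟨mem_famD_iff.2 ⟨γ, le_rfl⟩, fun h => hHF (famGen_mono hγ h)⟩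
  refine ⟨twistedDiag γ, ⟨hmem, hγ, fun L hL hle => ?_⟩, ?_⟩
  · exact le_antisymm hle (le_of_mem L hL.1 (hγ.trans hle))
  · rintro N ⟨hN, hHN, hmax⟩
    exact hmax _ hmem (le_of_mem N hN.1 hHN)
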